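/- Assume G_s and G_i are invertible and ξ̃_s ≠ 0. Then for every fixed Δx_i ∈ ℝ^{n_x}, the full linearized KKT system at the switch — consisting of equations (F1), (F2), (F3), the switching equation h_{x,i}ᵀ Δx_i + h_{u,i}ᵀ Δu_i + f_iᵀ Δλ_s − h_{x,s}ᵀ Δx_s − h_{u,s}ᵀ Δu_s − f_sᵀ Δλ' + h̄_s = 0, and equations (E1), (E2), (E3), (E4) — has a unique solution in the unknowns (Δλ_i, Δu_i, Δλ_s, Δt_s, Δx_s, Δu_s, Δλ', Δx') ∈ ℝ^{n_x} × ℝ^{n_u} × ℝ^{n_x} × ℝ × ℝ^{n_x} × ℝ^{n_u} × ℝ^{n_x} × ℝ^{n_x}. (Unique solvability of the switch-stage block linear system solved by the proposed Riccati recursion.) -/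

import Mathlib

open Matrix

lemma dot_tr {m n : ℕ} (a : Fin m → ℝ) (M : Matrix (Fin m) (Fin n) ℝ) (v : Fin n → ℝ) :
    a ⬝ᵥ (M *ᵥ v) = (Mᵀ *ᵥ a) ⬝ᵥ v := by
  rw [Matrix.dotProduct_mulVec, Matrix.mulVec_transpose]

/-- Backward elimination of stage `s` for the homogeneous system. -/
lemma stage_s_elim {nx nu : ℕ}
    (Qxxs P' : Matrix (Fin nx) (Fin nx) ℝ)
    (Quus : Matrix (Fin nu) (Fin nu) ℝ)
    (Qxus : Matrix (Fin nx) (Fin nu) ℝ)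
    (As : Matrix (Fin nx) (Fin nx) ℝ) (Bs : Matrix (Fin nx) (Fin nu) ℝ)
    (hxs fs : Fin nx → ℝ) (hus : Fin nu → ℝ)
    (hQuusSymm : Quus.IsSymm) (hP'Symm : P'.IsSymm)
    (Fs : Matrix (Fin nx) (Fin nx) ℝ) (hFs : Fs = Qxxs + Asᵀ * P' * As)
    (Hs : Matrix (Fin nx) (Fin nu) ℝ) (hHs : Hs = Qxus + Asᵀ * P' * Bs)
    (Gs : Matrix (Fin nu) (Fin nu) ℝ) (hGs : Gs = Quus + Bsᵀ * P' * Bs)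
    (hGsinv : IsUnit Gs)
    (Ks : Matrix (Fin nu) (Fin nx) ℝ) (hKs : Ks = -(Gs⁻¹ * Hsᵀ))
    (Ps : Matrix (Fin nx) (Fin nx) ℝ) (hPs : Ps = Fs - Ksᵀ * Gs * Ks)
    (ψxs : Fin nx → ℝ) (hψxs : ψxs = hxs + Asᵀ *ᵥ (P' *ᵥ fs))
    (ψus : Fin nu → ℝ) (hψus : ψus = hus + Bsᵀ *ᵥ (P' *ᵥ fs))
    (Γs : Fin nx → ℝ) (hΓs : Γs = ψxs + Ksᵀ *ᵥ ψus)
    (ξs : ℝ) (hξs : ξs = fs ⬝ᵥ (P' *ᵥ fs) - ψus ⬝ᵥ (Gs⁻¹ *ᵥ ψus))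
    (ls xs l' x' : Fin nx → ℝ) (us : Fin nu → ℝ) (t : ℝ)
    (e1 : Qxxs *ᵥ xs + Qxus *ᵥ us + Asᵀ *ᵥ l' - ls - t • hxs = 0)
    (e2 : Qxusᵀ *ᵥ xs + Quus *ᵥ us + Bsᵀ *ᵥ l' - t • hus = 0)
    (e3 : As *ᵥ xs + Bs *ᵥ us - x' - t • fs = 0)
    (e4 : l' - P' *ᵥ x' = 0) :
    us = Ks *ᵥ xs + t • (Gs⁻¹ *ᵥ ψus) ∧ ls = Ps *ᵥ xs - t • Γs ∧
      hxs ⬝ᵥ xs + hus ⬝ᵥ us + fs ⬝ᵥ l' = Γs ⬝ᵥ xs - t * ξs ∧ Psᵀ = Fsᵀ + Ksᵀ * Hsᵀ := by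
  have hdet : IsUnit Gs.det := (Matrix.isUnit_iff_isUnit_det _).1 hGsinv
  have hP : P'ᵀ = P' := hP'Symm
  have hQ : Quusᵀ = Quus := hQuusSymm
  have hG : Gsᵀ = Gs := by
    rw [hGs]; simp [Matrix.transpose_mul, hP, hQ, Matrix.mul_assoc]
  have hGK : Gs * Ks = -Hsᵀ := by
    rw [hKs, Matrix.mul_neg, Matrix.mul_nonsing_inv_cancel_left _ _ hdet]
  have hKt : Ksᵀ = -(Hs * Gs⁻¹) := by
    rw [hKs]; simp [Matrix.transpose_mul, Matrix.transpose_nonsing_inv, hG]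
  have hP1 : Ps = Fs + Hs * Ks := by
    rw [hPs, Matrix.mul_assoc, hGK, hKt, hKs]; simp [Matrix.mul_assoc, sub_eq_add_neg]
  have hP2 : Psᵀ = Fsᵀ + Ksᵀ * Hsᵀ := by
    rw [hP1]; simp [Matrix.transpose_mul]
  have hHt : Hsᵀ = Qxusᵀ + Bsᵀ * P' * As := by
    rw [hHs]; simp [Matrix.transpose_mul, hP, Matrix.mul_assoc]
  have x'e : x' = As *ᵥ xs + Bs *ᵥ us - t • fs := by
    rw [← sub_eq_zero, ← neg_eq_zero, ← e3]; abel
  have l'e : l' = P' *ᵥ (As *ᵥ xs + Bs *ᵥ us - t • fs) := by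
    rw [← x'e]; exact sub_eq_zero.1 e4
  have hGu : Gs *ᵥ us = -(Hsᵀ *ᵥ xs) + t • ψus := by
    rw [← sub_eq_zero, ← e2, l'e, hGs, hHt, hψus]
    simp only [Matrix.mulVec_add, Matrix.mulVec_sub, Matrix.mulVec_smul, Matrix.add_mulVec,
      ← Matrix.mulVec_mulVec]
    module
  have use : us = Ks *ᵥ xs + t • (Gs⁻¹ *ᵥ ψus) := by
    have : Gs⁻¹ *ᵥ (Gs *ᵥ us) = us := by
      rw [Matrix.mulVec_mulVec, Matrix.nonsing_inv_mul _ hdet, Matrix.one_mulVec]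
    rw [← this, hGu, hKs]
    simp only [Matrix.mulVec_add, Matrix.mulVec_neg, Matrix.mulVec_smul, Matrix.neg_mulVec,
      ← Matrix.mulVec_mulVec]
  have lse : ls = Fs *ᵥ xs + Hs *ᵥ us - t • ψxs := by
    rw [← sub_eq_zero, ← neg_eq_zero, ← e1, l'e, hFs, hHs, hψxs]
    simp only [Matrix.mulVec_add, Matrix.mulVec_sub, Matrix.mulVec_smul, Matrix.add_mulVec,
      ← Matrix.mulVec_mulVec]
    module
  refine ⟨use, ?_, ?_, hP2⟩
  · rw [lse, use, hP1, hΓs, hKt]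
    simp only [Matrix.mulVec_add, Matrix.mulVec_smul, Matrix.add_mulVec, Matrix.neg_mulVec,
      ← Matrix.mulVec_mulVec]
    module
  · have h1 : hxs ⬝ᵥ xs + hus ⬝ᵥ us + fs ⬝ᵥ l' =
        ψxs ⬝ᵥ xs + ψus ⬝ᵥ us - t * (fs ⬝ᵥ (P' *ᵥ fs)) := by
      rw [l'e, hψxs, hψus, dot_tr fs P', hP]
      simp only [dotProduct_add, dotProduct_sub, dotProduct_smul, add_dotProduct, dot_tr _ As,
        dot_tr _ Bs, smul_eq_mul, dotProduct_comm (P' *ᵥ fs) fs]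
      ring
    rw [h1, use, hΓs, hξs]
    simp only [dotProduct_add, dotProduct_smul, add_dotProduct, dot_tr ψus Ks, smul_eq_mul]
    ring

/-- The homogeneous switch-stage system has only the zero solution. -/
lemma switch_homogeneous {nx nu : ℕ}
    (Qxxs P' : Matrix (Fin nx) (Fin nx) ℝ)
    (Quus : Matrix (Fin nu) (Fin nu) ℝ)
    (Qxus : Matrix (Fin nx) (Fin nu) ℝ)
    (As : Matrix (Fin nx) (Fin nx) ℝ) (Bs : Matrix (Fin nx) (Fin nu) ℝ)
    (hxs fs : Fin nx → ℝ) (hus : Fin nu → ℝ)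
    (Qxxi : Matrix (Fin nx) (Fin nx) ℝ)
    (Quui : Matrix (Fin nu) (Fin nu) ℝ)
    (Qxui : Matrix (Fin nx) (Fin nu) ℝ)
    (Ai : Matrix (Fin nx) (Fin nx) ℝ) (Bi : Matrix (Fin nx) (Fin nu) ℝ)
    (hxi fi : Fin nx → ℝ) (hui : Fin nu → ℝ)
    (hQxxsSymm : Qxxs.IsSymm) (hQuusSymm : Quus.IsSymm) (hP'Symm : P'.IsSymm)
    (hQxxiSymm : Qxxi.IsSymm) (hQuuiSymm : Quui.IsSymm)
    (Fs : Matrix (Fin nx) (Fin nx) ℝ) (hFs : Fs = Qxxs + Asᵀ * P' * As)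
    (Hs : Matrix (Fin nx) (Fin nu) ℝ) (hHs : Hs = Qxus + Asᵀ * P' * Bs)
    (Gs : Matrix (Fin nu) (Fin nu) ℝ) (hGs : Gs = Quus + Bsᵀ * P' * Bs)
    (hGsinv : IsUnit Gs)
    (Ks : Matrix (Fin nu) (Fin nx) ℝ) (hKs : Ks = -(Gs⁻¹ * Hsᵀ))
    (Ps : Matrix (Fin nx) (Fin nx) ℝ) (hPs : Ps = Fs - Ksᵀ * Gs * Ks)
    (ψxs : Fin nx → ℝ) (hψxs : ψxs = hxs + Asᵀ *ᵥ (P' *ᵥ fs))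
    (ψus : Fin nu → ℝ) (hψus : ψus = hus + Bsᵀ *ᵥ (P' *ᵥ fs))
    (Γs : Fin nx → ℝ) (hΓs : Γs = ψxs + Ksᵀ *ᵥ ψus)
    (ξs : ℝ) (hξs : ξs = fs ⬝ᵥ (P' *ᵥ fs) - ψus ⬝ᵥ (Gs⁻¹ *ᵥ ψus))
    (Gi : Matrix (Fin nu) (Fin nu) ℝ) (hGi : Gi = Quui + Biᵀ * Ps * Bi)
    (hGiinv : IsUnit Gi)
    (Ki : Matrix (Fin nu) (Fin nx) ℝ) (hKi : Ki = -(Gi⁻¹ * (Qxui + Aiᵀ * Ps * Bi)ᵀ))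
    (ψui : Fin nu → ℝ) (hψui : ψui = hui + Biᵀ *ᵥ (Ps *ᵥ fi) - Biᵀ *ᵥ Γs)
    (ξts : ℝ) (hξts : ξts = ξs - 2 * (Γs ⬝ᵥ fi) + fi ⬝ᵥ (Ps *ᵥ fi) - ψui ⬝ᵥ (Gi⁻¹ *ᵥ ψui))
    (hξtsne : ξts ≠ 0)
    (li ls xs l' x' : Fin nx → ℝ) (ui us : Fin nu → ℝ) (t : ℝ)
    (f1 : Qxui *ᵥ ui + Aiᵀ *ᵥ ls - li + t • hxi = 0)
    (f2 : Quui *ᵥ ui + Biᵀ *ᵥ ls + t • hui = 0)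
    (f3 : Bi *ᵥ ui - xs + t • fi = 0)
    (sw : hui ⬝ᵥ ui + fi ⬝ᵥ ls - hxs ⬝ᵥ xs - hus ⬝ᵥ us - fs ⬝ᵥ l' = 0)
    (e1 : Qxxs *ᵥ xs + Qxus *ᵥ us + Asᵀ *ᵥ l' - ls - t • hxs = 0)
    (e2 : Qxusᵀ *ᵥ xs + Quus *ᵥ us + Bsᵀ *ᵥ l' - t • hus = 0)
    (e3 : As *ᵥ xs + Bs *ᵥ us - x' - t • fs = 0)
    (e4 : l' - P' *ᵥ x' = 0) :
    li = 0 ∧ ui = 0 ∧ ls = 0 ∧ t = 0 ∧ xs = 0 ∧ us = 0 ∧ l' = 0 ∧ x' = 0 := by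
  obtain ⟨use, lse, hsw, hPt⟩ := stage_s_elim Qxxs P' Quus Qxus As Bs hxs fs hus hQuusSymm hP'Symm
    Fs hFs Hs hHs Gs hGs hGsinv Ks hKs Ps hPs ψxs hψxs ψus hψus Γs hΓs ξs hξs ls xs l' x' us t
    e1 e2 e3 e4
  have hdet : IsUnit Gi.det := (Matrix.isUnit_iff_isUnit_det _).1 hGiinv
  have hP : P'ᵀ = P' := hP'Symm
  have hPst : Psᵀ = Ps := by
    have hG : Gsᵀ = Gs := by
      rw [hGs]; simp [Matrix.transpose_mul, hP, hQuusSymm.eq, Matrix.mul_assoc]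
    rw [hPs, hFs]
    simp [Matrix.transpose_mul, hP, hG, hQxxsSymm.eq, Matrix.mul_assoc]
  have xse : xs = Bi *ᵥ ui + t • fi := by
    rw [← sub_eq_zero, ← neg_eq_zero, ← f3]; abel
  have hGu : Gi *ᵥ ui = -(t • ψui) := by
    rw [← sub_eq_zero, ← f2, lse, xse, hGi, hψui]
    simp only [Matrix.mulVec_add, Matrix.mulVec_sub, Matrix.mulVec_smul, Matrix.add_mulVec,
      ← Matrix.mulVec_mulVec]
    module
  have uie : ui = -(t • (Gi⁻¹ *ᵥ ψui)) := by
    have : Gi⁻¹ *ᵥ (Gi *ᵥ ui) = ui := by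
      rw [Matrix.mulVec_mulVec, Matrix.nonsing_inv_mul _ hdet, Matrix.one_mulVec]
    rw [← this, hGu, Matrix.mulVec_neg, Matrix.mulVec_smul]
  have hsw2 : ψui ⬝ᵥ ui + t * (ξs - 2 * (Γs ⬝ᵥ fi) + fi ⬝ᵥ (Ps *ᵥ fi)) = 0 := by
    have h0 : hui ⬝ᵥ ui + fi ⬝ᵥ ls - (Γs ⬝ᵥ xs - t * ξs) = 0 := by
      rw [← hsw, ← sw]; ring
    rw [← h0, lse, xse, hψui, dotProduct_sub, dot_tr fi Ps fi, dot_tr fi Ps, hPst]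
    simp only [dotProduct_add, dotProduct_smul, add_dotProduct, sub_dotProduct,
      dot_tr _ Bi, smul_eq_mul, dotProduct_comm fi Γs]
    ring
  have ht : t = 0 := by
    have : t * ξts = 0 := by
      rw [← hsw2, hξts]
      conv_rhs => rw [uie]
      simp only [dotProduct_neg, dotProduct_smul, smul_eq_mul]
      ring
    exact (mul_eq_zero.1 this).resolve_right hξtsne
  subst ht
  have hui0 : ui = 0 := by simpa using uie
  subst hui0
  have hxs0 : xs = 0 := by simpa using xse
  subst hxs0
  have hus0 : us = 0 := by simpa using use
  subst hus0
  have hls0 : ls = 0 := by simpa using lse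
  subst hls0
  have hx0 : x' = 0 := by simpa using e3
  subst hx0
  have hl0 : l' = 0 := by simpa using e4
  have hli0 : li = 0 := by simpa using f1
  exact ⟨hli0, rfl, rfl, rfl, rfl, rfl, hl0, rfl⟩

/-- Unique solvability of the switch-stage block linear system solved by the
proposed Riccati recursion: if `G_s`, `G_i` are invertible and `ξ̃_s ≠ 0`, then
for every fixed `Δx_i` the full linearized KKT system at the switch has a unique
solution `(Δλ_i, Δu_i, Δλ_s, Δt_s, Δx_s, Δu_s, Δλ', Δx')`. -/
theorem switch_stage_unique_solvability {nx nu : ℕ}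
    (Qxxs P' : Matrix (Fin nx) (Fin nx) ℝ)
    (Quus : Matrix (Fin nu) (Fin nu) ℝ)
    (Qxus : Matrix (Fin nx) (Fin nu) ℝ)
    (As : Matrix (Fin nx) (Fin nx) ℝ) (Bs : Matrix (Fin nx) (Fin nu) ℝ)
    (hxs fs lxs xbs z' : Fin nx → ℝ) (hus lus : Fin nu → ℝ) (hbs : ℝ)
    (Qxxi : Matrix (Fin nx) (Fin nx) ℝ)
    (Quui : Matrix (Fin nu) (Fin nu) ℝ)
    (Qxui : Matrix (Fin nx) (Fin nu) ℝ)
    (Ai : Matrix (Fin nx) (Fin nx) ℝ) (Bi : Matrix (Fin nx) (Fin nu) ℝ)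
    (hxi fi lxi xbi : Fin nx → ℝ) (hui lui : Fin nu → ℝ)
    (hQxxsSymm : Qxxs.IsSymm) (hQuusSymm : Quus.IsSymm) (hP'Symm : P'.IsSymm)
    (hQxxiSymm : Qxxi.IsSymm) (hQuuiSymm : Quui.IsSymm)
    (Fs : Matrix (Fin nx) (Fin nx) ℝ) (hFs : Fs = Qxxs + Asᵀ * P' * As)
    (Hs : Matrix (Fin nx) (Fin nu) ℝ) (hHs : Hs = Qxus + Asᵀ * P' * Bs)
    (Gs : Matrix (Fin nu) (Fin nu) ℝ) (hGs : Gs = Quus + Bsᵀ * P' * Bs)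
    (hGsinv : IsUnit Gs)
    (Ks : Matrix (Fin nu) (Fin nx) ℝ) (hKs : Ks = -(Gs⁻¹ * Hsᵀ))
    (Ps : Matrix (Fin nx) (Fin nx) ℝ) (hPs : Ps = Fs - Ksᵀ * Gs * Ks)
    (ψxs : Fin nx → ℝ) (hψxs : ψxs = hxs + Asᵀ *ᵥ (P' *ᵥ fs))
    (ψus : Fin nu → ℝ) (hψus : ψus = hus + Bsᵀ *ᵥ (P' *ᵥ fs))
    (Γs : Fin nx → ℝ) (hΓs : Γs = ψxs + Ksᵀ *ᵥ ψus)
    (ξs : ℝ) (hξs : ξs = fs ⬝ᵥ (P' *ᵥ fs) - ψus ⬝ᵥ (Gs⁻¹ *ᵥ ψus))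
    (Gi : Matrix (Fin nu) (Fin nu) ℝ) (hGi : Gi = Quui + Biᵀ * Ps * Bi)
    (hGiinv : IsUnit Gi)
    (Ki : Matrix (Fin nu) (Fin nx) ℝ) (hKi : Ki = -(Gi⁻¹ * (Qxui + Aiᵀ * Ps * Bi)ᵀ))
    (ψui : Fin nu → ℝ) (hψui : ψui = hui + Biᵀ *ᵥ (Ps *ᵥ fi) - Biᵀ *ᵥ Γs)
    (ξts : ℝ) (hξts : ξts = ξs - 2 * (Γs ⬝ᵥ fi) + fi ⬝ᵥ (Ps *ᵥ fi) - ψui ⬝ᵥ (Gi⁻¹ *ᵥ ψui))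
    (hξtsne : ξts ≠ 0)
    (Δxi : Fin nx → ℝ) :
    ∃! w : (Fin nx → ℝ) × (Fin nu → ℝ) × (Fin nx → ℝ) × ℝ ×
        (Fin nx → ℝ) × (Fin nu → ℝ) × (Fin nx → ℝ) × (Fin nx → ℝ),
      match w with
      | (Δli, Δui, Δls, Δts, Δxs, Δus, Δl', Δx') =>
        (Qxxi *ᵥ Δxi + Qxui *ᵥ Δui + Aiᵀ *ᵥ Δls - Δli + Δts • hxi + lxi = 0) ∧
        (Qxuiᵀ *ᵥ Δxi + Quui *ᵥ Δui + Biᵀ *ᵥ Δls + Δts • hui + lui = 0) ∧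
        (Ai *ᵥ Δxi + Bi *ᵥ Δui - Δxs + Δts • fi + xbi = 0) ∧
        (hxi ⬝ᵥ Δxi + hui ⬝ᵥ Δui + fi ⬝ᵥ Δls
          - hxs ⬝ᵥ Δxs - hus ⬝ᵥ Δus - fs ⬝ᵥ Δl' + hbs = 0) ∧
        (Qxxs *ᵥ Δxs + Qxus *ᵥ Δus + Asᵀ *ᵥ Δl' - Δls - Δts • hxs + lxs = 0) ∧
        (Qxusᵀ *ᵥ Δxs + Quus *ᵥ Δus + Bsᵀ *ᵥ Δl' - Δts • hus + lus = 0) ∧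
        (As *ᵥ Δxs + Bs *ᵥ Δus - Δx' - Δts • fs + xbs = 0) ∧
        (Δl' = P' *ᵥ Δx' - z') := by
  let L : ((Fin nx → ℝ) × (Fin nu → ℝ) × (Fin nx → ℝ) × ℝ ×
        (Fin nx → ℝ) × (Fin nu → ℝ) × (Fin nx → ℝ) × (Fin nx → ℝ)) →ₗ[ℝ]
      ((Fin nx → ℝ) × (Fin nu → ℝ) × (Fin nx → ℝ) × ℝ ×
        (Fin nx → ℝ) × (Fin nu → ℝ) × (Fin nx → ℝ) × (Fin nx → ℝ)) :=
    { toFun := fun w =>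
        (Qxui *ᵥ w.2.1 + Aiᵀ *ᵥ w.2.2.1 - w.1 + w.2.2.2.1 • hxi,
        Quui *ᵥ w.2.1 + Biᵀ *ᵥ w.2.2.1 + w.2.2.2.1 • hui,
        Bi *ᵥ w.2.1 - w.2.2.2.2.1 + w.2.2.2.1 • fi,
        hui ⬝ᵥ w.2.1 + fi ⬝ᵥ w.2.2.1 - hxs ⬝ᵥ w.2.2.2.2.1 - hus ⬝ᵥ w.2.2.2.2.2.1
          - fs ⬝ᵥ w.2.2.2.2.2.2.1,
        Qxxs *ᵥ w.2.2.2.2.1 + Qxus *ᵥ w.2.2.2.2.2.1 + Asᵀ *ᵥ w.2.2.2.2.2.2.1 - w.2.2.1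
          - w.2.2.2.1 • hxs,
        Qxusᵀ *ᵥ w.2.2.2.2.1 + Quus *ᵥ w.2.2.2.2.2.1 + Bsᵀ *ᵥ w.2.2.2.2.2.2.1
          - w.2.2.2.1 • hus,
        As *ᵥ w.2.2.2.2.1 + Bs *ᵥ w.2.2.2.2.2.1 - w.2.2.2.2.2.2.2 - w.2.2.2.1 • fs,
        w.2.2.2.2.2.2.1 - P' *ᵥ w.2.2.2.2.2.2.2)
      map_add' := by
        intro v w
        simp only [Prod.fst_add, Prod.snd_add, Matrix.mulVec_add, dotProduct_add, add_smul,
          Prod.mk_add_mk, Prod.mk.injEq]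
        refine ⟨?_, ?_, ?_, ?_, ?_, ?_, ?_, ?_⟩ <;> first | module | ring
      map_smul' := by
        intro c w
        simp only [Prod.smul_fst, Prod.smul_snd, Matrix.mulVec_smul, dotProduct_smul,
          Prod.smul_mk, Prod.mk.injEq, RingHom.id_apply, smul_eq_mul]
        refine ⟨?_, ?_, ?_, ?_, ?_, ?_, ?_, ?_⟩ <;> first | module | ring }
  have hinj : Function.Injective L := by
    rw [injective_iff_map_eq_zero]
    rintro ⟨li, ui, ls, t, xs, us, l', x'⟩ h
    have h' := h
    simp only [L, LinearMap.coe_mk, AddHom.coe_mk, Prod.mk_eq_zero] at h'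
    obtain ⟨f1, f2, f3, sw, e1, e2, e3, e4⟩ := h'
    obtain ⟨h1, h2, h3, h4, h5, h6, h7, h8⟩ := switch_homogeneous
      Qxxs P' Quus Qxus As Bs hxs fs hus Qxxi Quui Qxui Ai Bi hxi fi hui hQxxsSymm hQuusSymm
      hP'Symm hQxxiSymm hQuuiSymm Fs hFs Hs hHs Gs hGs hGsinv Ks hKs Ps hPs ψxs hψxs ψus hψus
      Γs hΓs ξs hξs Gi hGi hGiinv Ki hKi ψui hψui ξts hξts hξtsne
      li ls xs l' x' ui us t f1 f2 f3 sw e1 e2 e3 e4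
    simp [h1, h2, h3, h4, h5, h6, h7, h8]
  have hsurj : Function.Surjective L := LinearMap.injective_iff_surjective.1 hinj
  have key := (Function.Bijective.existsUnique ⟨hinj, hsurj⟩)
    (-(Qxxi *ᵥ Δxi + lxi), -(Qxuiᵀ *ᵥ Δxi + lui), -(Ai *ᵥ Δxi + xbi), -(hxi ⬝ᵥ Δxi + hbs),
      -lxs, -lus, -xbs, -z')
  refine (existsUnique_congr ?_).1 key
  rintro ⟨li, ui, ls, t, xs, us, l', x'⟩
  simp only [L, LinearMap.coe_mk, AddHom.coe_mk, Prod.mk.injEq]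
  refine and_congr ?_ (and_congr ?_ (and_congr ?_ (and_congr ?_ (and_congr ?_ (and_congr ?_
    (and_congr ?_ ?_))))))
  all_goals
    rw [← sub_eq_zero]
    try rw [← sub_eq_zero (a := l')]
    apply Eq.congr_left
    first | module | ring
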